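/- For all 1 ≤ i, j ≤ n and all m, p ∈ ℤ, the intermediate Wakimoto operators satisfy relation (R4): [ρ(E_i)_m, ρ(F_j)_p] = δ_{ij} · (ρ(H_i)_{m+p} + c₀ · m · δ_{m+p,0} · id), where c₀ = γ² − (r+1). -/

import Mathlib

open MvPolynomial

/-- The Cartan matrix of `sl(n+1, ℂ)` in 1-based indices. -/
noncomputable def cartanEntry (i j : ℕ) : ℂ :=
  if i = j then 2 else if i + 1 = j ∨ j + 1 = i then -1 else 0

/-- The entries of the matrix `𝔅` (1-based indices). -/
noncomputable def Bentry (r : ℕ) (γ : ℂ) (i j : ℕ) : ℂ :=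
  cartanEntry i j *
    (γ ^ 2 - (if r < i then 1 else 0) * (if r < j then 1 else 0) * ((r : ℂ) + 1)
      + ((r : ℂ) / 2) * (if i = r + 1 then 1 else 0) * (if j = r + 1 then 1 else 0))

/-- Index set for the variables `x_{ij,m}`, `1 ≤ i ≤ j ≤ n`, `m ∈ ℤ`. -/
abbrev XIdx (n : ℕ) : Type := {v : ℕ × ℕ // 1 ≤ v.1 ∧ v.1 ≤ v.2 ∧ v.2 ≤ n} × ℤ

/-- Index set for the variables `y_{k,m}`, `1 ≤ k ≤ n` (encoded by `Fin n`,
`k ↦ k + 1`) and `m ≥ 1`. -/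
abbrev YIdx (n : ℕ) : Type := Fin n × {m : ℕ // 1 ≤ m}

/-- The Fock space `F = ℂ[x_{ij,m}; y_{k,m}]`. -/
abbrev FSp (n : ℕ) : Type := MvPolynomial (XIdx n ⊕ YIdx n) ℂ

/-- The operator `a_{ij,m}`: it is `∂/∂x_{ij,m}` if `m ≥ 0` and `j ≤ r`, and
multiplication by `x_{ij,m}` otherwise (and junk `0` for invalid indices `i, j`,
which are never used).  Applied to any fixed polynomial, all the `∑ᶠ` sums
appearing below have finite support, so they compute the intended operators. -/
noncomputable def aop (n r i j : ℕ) (m : ℤ) : FSp n → FSp n :=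
  if h : 1 ≤ i ∧ i ≤ j ∧ j ≤ n then
    (if 0 ≤ m ∧ j ≤ r then fun q => pderiv (Sum.inl (⟨(i, j), h⟩, m)) q
     else fun q => X (Sum.inl (⟨(i, j), h⟩, m)) * q)
  else 0

/-- The operator `a*_{ij,m}`: multiplication by `x_{ij,−m}` if `m ≤ 0` and `j ≤ r`,
and `−∂/∂x_{ij,−m}` otherwise. -/
noncomputable def astarop (n r i j : ℕ) (m : ℤ) : FSp n → FSp n :=
  if h : 1 ≤ i ∧ i ≤ j ∧ j ≤ n then
    (if m ≤ 0 ∧ j ≤ r then fun q => X (Sum.inl (⟨(i, j), h⟩, -m)) * q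
     else fun q => -pderiv (Sum.inl (⟨(i, j), h⟩, -m)) q)
  else 0

/-- The polynomial `e_i·𝐲_m = Σ_{k=1}^n (e_i)_k y_{k,m}`. -/
noncomputable def yPoly (n : ℕ) (e : ℕ → ℕ → ℂ) (i : ℕ) (m : {m : ℕ // 1 ≤ m}) :
    FSp n :=
  ∑ k : Fin n, e i (k.1 + 1) • X (Sum.inr (k, m))

/-- The operator `b_{i,m}`:  `b_{i,0} = λ_i · id`; for `m > 0`, `b_{i,−m}` is
multiplication by `e_i·𝐲_m` and `b_{i,m} = m Σ_k (e_i)_k ∂/∂y_{k,m}`. -/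
noncomputable def bop (n : ℕ) (e : ℕ → ℕ → ℂ) (lam : ℕ → ℂ) (i : ℕ) (m : ℤ) :
    FSp n → FSp n :=
  if h : 0 < m then
    fun q => (m : ℂ) • ∑ k : Fin n,
      e i (k.1 + 1) • pderiv (Sum.inr (k, ⟨m.toNat, by omega⟩)) q
  else if h' : m = 0 then fun q => lam i • q
  else fun q => yPoly n e i ⟨(-m).toNat, by omega⟩ * q

/-- The normally ordered pair `:a_{ij,u} a*_{kl,v}:` : the annihilation operator
(`a_{ij,u}` with `u ≥ 0`, `j ≤ r`) is moved to the right of the creation operator. -/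
noncomputable def nAA (n r i j k l : ℕ) (u v : ℤ) : FSp n → FSp n :=
  if 0 ≤ u ∧ j ≤ r then fun q => astarop n r k l v (aop n r i j u q)
  else fun q => aop n r i j u (astarop n r k l v q)

/-- Mode `m` (coefficient of `z^{−m−1}`) of the normally ordered product
`:a_{ij}(z) a*_{kl}(z):`. -/
noncomputable def nAAmode (n r i j k l : ℕ) (m : ℤ) : FSp n → FSp n :=
  fun q => ∑ᶠ s : ℤ, nAA n r i j k l s (m - s) q

/-- Normal ordering of the mode `a*_{ij,s}` against an operator `B`: an
annihilating `a*_{ij,s}` (i.e. `s > 0` and `j ≤ r`, or `j > r`) is moved to the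
right of `B`. -/
noncomputable def nStar (n r i j : ℕ) (s : ℤ) (B : FSp n → FSp n) : FSp n → FSp n :=
  if (j ≤ r ∧ 0 < s) ∨ r < j then fun q => B (astarop n r i j s q)
  else fun q => astarop n r i j s (B q)

/-- The intermediate Wakimoto mode operator `ρ(H_i)_m`. -/
noncomputable def rhoH (n r : ℕ) (e : ℕ → ℕ → ℂ) (lam : ℕ → ℂ) (i : ℕ) (m : ℤ) :
    FSp n → FSp n :=
  fun q => (2 : ℂ) • nAAmode n r i i i i m q
    + ∑ j ∈ Finset.Ico 1 i,
        (nAAmode n r j i j i m q - nAAmode n r j (i - 1) j (i - 1) m q)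
    + ∑ j ∈ Finset.Icc (i + 1) n,
        (nAAmode n r i j i j m q - nAAmode n r (i + 1) j (i + 1) j m q)
    + bop n e lam i m q

/-- The intermediate Wakimoto mode operator `ρ(F_i)_m`. -/
noncomputable def rhoF (n r i : ℕ) (m : ℤ) : FSp n → FSp n :=
  fun q => aop n r i i m q
    + ∑ j ∈ Finset.Icc (i + 1) n,
        ∑ᶠ s : ℤ, aop n r i j s (astarop n r (i + 1) j (m - s) q)

/-- The intermediate Wakimoto mode operator `ρ(E_i)_m`. -/
noncomputable def rhoE (n r : ℕ) (γ : ℂ) (e : ℕ → ℕ → ℂ) (lam : ℕ → ℂ) (i : ℕ)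
    (m : ℤ) : FSp n → FSp n :=
  fun q =>
    (∑ᶠ s : ℤ, nStar n r i i s
        ((∑ k ∈ Finset.Ico 1 i, nAAmode n r k (i - 1) k (i - 1) (m - s))
          - ∑ k ∈ Finset.Icc 1 i, nAAmode n r k i k i (m - s)) q)
    + ∑ k ∈ Finset.Icc (i + 1) n,
        ∑ᶠ s : ℤ, aop n r (i + 1) k s (astarop n r i k (m - s) q)
    - ∑ k ∈ Finset.Ico 1 i,
        ∑ᶠ s : ℤ, aop n r k (i - 1) s (astarop n r k i (m - s) q)
    - ∑ᶠ s : ℤ, astarop n r i i s (bop n e lam i (m - s) q)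
    - ((if r < i then (r : ℂ) + 1 else (i : ℂ) + 1) - γ ^ 2) •
        ((-(m : ℂ)) • astarop n r i i m q)

/-- Commutator of two operators. -/
noncomputable def opComm (n : ℕ) (A B : FSp n → FSp n) : FSp n → FSp n :=
  fun q => A (B q) - B (A q)

/-! ### Locally finite families of operators -/

attribute [local instance] LieRing.ofAssociativeRing

section LocallyFinite

open Filter

variable {V : Type*} [AddCommGroup V] [Module ℂ V]

/-- A family of operators is locally finite if on each vector almost all of them vanish. -/
def LocFin (f : ℤ → Module.End ℂ V) : Prop := ∀ q, ∀ᶠ s in cofinite, f s q = 0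

lemma LocFin.hasFiniteSupport {f : ℤ → Module.End ℂ V} (hf : LocFin f) (q : V) :
    Function.HasFiniteSupport fun s => f s q := hf q

open Classical in
/-- The pointwise sum of a locally finite family of operators (`0` if the family is not
locally finite). -/
noncomputable def lsum (f : ℤ → Module.End ℂ V) : Module.End ℂ V :=
  if hf : LocFin f then
    { toFun := fun q => ∑ᶠ s, f s q
      map_add' := fun q q' => by
        simp only [map_add]
        exact finsum_add_distrib (hf.hasFiniteSupport q) (hf.hasFiniteSupport q')
      map_smul' := fun c q => by
        simp only [map_smul, RingHom.id_apply]
        exact (smul_finsum' c (hf.hasFiniteSupport q)).symm }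
  else 0

lemma lsum_apply {f : ℤ → Module.End ℂ V} (hf : LocFin f) (q : V) :
    lsum f q = ∑ᶠ s, f s q := by
  simp [lsum, hf]

lemma LocFin.add {f g : ℤ → Module.End ℂ V} (hf : LocFin f) (hg : LocFin g) :
    LocFin fun s => f s + g s := fun q => by
  filter_upwards [hf q, hg q] with s h h'
  simp [h, h']

lemma LocFin.neg {f : ℤ → Module.End ℂ V} (hf : LocFin f) : LocFin fun s => -f s := fun q => by
  filter_upwards [hf q] with s h
  simp [h]

lemma LocFin.sub {f g : ℤ → Module.End ℂ V} (hf : LocFin f) (hg : LocFin g) :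
    LocFin fun s => f s - g s := fun q => by
  filter_upwards [hf q, hg q] with s h h'
  simp [h, h']

lemma LocFin.lie {f : ℤ → Module.End ℂ V} (hf : LocFin f) (G : Module.End ℂ V) :
    LocFin fun s => ⁅f s, G⁆ := fun q => by
  filter_upwards [hf q, hf (G q)] with s h h'
  simp [Ring.lie_def, h, h']

lemma locFin_of_eq_zero {f : ℤ → Module.End ℂ V} (c : ℤ) (h : ∀ s, s ≠ c → f s = 0) :
    LocFin f := fun q =>
  (Set.finite_singleton c).subset fun s hs => by
    by_contra hc
    exact hs (by simp [h s hc])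

lemma LocFin.shift {f : ℤ → Module.End ℂ V} (hf : LocFin f) (c : ℤ) :
    LocFin fun s => f (s + c) := fun q =>
  (add_left_injective c).tendsto_cofinite.eventually (hf q)

lemma locFin_of_top_bot {f : ℤ → Module.End ℂ V} (h : ∀ q, ∀ᶠ s in atTop, f s q = 0)
    (h' : ∀ q, ∀ᶠ s in atBot, f s q = 0) : LocFin f := fun q => by
  rw [Int.cofinite_eq, eventually_sup]
  exact ⟨h' q, h q⟩

lemma lsum_add {f g : ℤ → Module.End ℂ V} (hf : LocFin f) (hg : LocFin g) :
    lsum (fun s => f s + g s) = lsum f + lsum g := by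
  ext q
  rw [lsum_apply (hf.add hg), LinearMap.add_apply, lsum_apply hf, lsum_apply hg]
  exact finsum_add_distrib (hf.hasFiniteSupport q) (hg.hasFiniteSupport q)

lemma lsum_neg {f : ℤ → Module.End ℂ V} (hf : LocFin f) : lsum (fun s => -f s) = -lsum f := by
  ext q
  rw [lsum_apply hf.neg, LinearMap.neg_apply, lsum_apply hf, ← finsum_neg_distrib]
  rfl

lemma lsum_sub {f g : ℤ → Module.End ℂ V} (hf : LocFin f) (hg : LocFin g) :
    lsum (fun s => f s - g s) = lsum f - lsum g := by
  simp only [sub_eq_add_neg]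
  rw [lsum_add hf hg.neg, lsum_neg hg]

lemma lsum_lie {f : ℤ → Module.End ℂ V} (hf : LocFin f) (G : Module.End ℂ V) :
    ⁅lsum f, G⁆ = lsum fun s => ⁅f s, G⁆ := by
  ext q
  rw [lsum_apply (hf.lie G)]
  simp only [Ring.lie_def, LinearMap.sub_apply, Module.End.mul_apply]
  rw [lsum_apply hf, lsum_apply hf,
    finsum_sub_distrib (hf.hasFiniteSupport (G q))
      ((hf.hasFiniteSupport q).subset fun s hs => by
        contrapose! hs
        simp_all)]
  congr 1
  exact G.toAddMonoidHom.map_finsum (hf.hasFiniteSupport q)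

lemma lie_lsum {f : ℤ → Module.End ℂ V} (hf : LocFin f) (G : Module.End ℂ V) :
    ⁅G, lsum f⁆ = lsum fun s => ⁅G, f s⁆ := by
  rw [← lie_skew, lsum_lie hf, ← lsum_neg (hf.lie G)]
  simp only [lie_skew]

lemma lsum_eq_single {f : ℤ → Module.End ℂ V} (c : ℤ) (h : ∀ s, s ≠ c → f s = 0) :
    lsum f = f c := by
  ext q
  rw [lsum_apply (locFin_of_eq_zero c h), finsum_eq_single _ c fun s hs => by simp [h s hs]]

lemma lsum_zero : lsum (fun _ => (0 : Module.End ℂ V)) = 0 :=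
  lsum_eq_single 0 fun _ _ => rfl

lemma lsum_shift {f : ℤ → Module.End ℂ V} (hf : LocFin f) (c : ℤ) :
    lsum (fun s => f (s + c)) = lsum f := by
  ext q
  rw [lsum_apply (hf.shift c), lsum_apply hf]
  exact finsum_comp_equiv (Equiv.addRight c) (f := fun s => f s q)

lemma lsum_reflect {f : ℤ → Module.End ℂ V} (hf : LocFin f) (c : ℤ) :
    lsum (fun s => f (c - s)) = lsum f := by
  have h : LocFin fun s => f (c - s) := fun q =>
    (sub_right_injective (b := c)).tendsto_cofinite.eventually (hf q)
  ext q
  rw [lsum_apply h, lsum_apply hf]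
  exact finsum_comp_equiv (Equiv.subLeft c) (f := fun s => f s q)

lemma lsum_smul_one {c : ℤ → ℂ} (hc : LocFin fun s => c s • (1 : Module.End ℂ V)) :
    lsum (fun s => c s • (1 : Module.End ℂ V)) = (∑ᶠ s, c s) • 1 := by
  ext q
  rw [lsum_apply hc, LinearMap.smul_apply, Module.End.one_apply, finsum_smul]
  rfl

lemma end_neg_mul (x y : Module.End ℂ V) : -x * y = -(x * y) := rfl

lemma end_mul_neg (x y : Module.End ℂ V) : x * -y = -(x * y) :=
  LinearMap.ext fun q => map_neg x (y q)

lemma end_neg_one_mul (x : Module.End ℂ V) : -1 * x = -x := rfl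

lemma end_mul_neg_one (x : Module.End ℂ V) : x * -1 = -x :=
  LinearMap.ext fun q => map_neg x q

lemma end_neg_smul (c : ℂ) (x : Module.End ℂ V) : (-c) • x = -(c • x) :=
  neg_smul c x

lemma mul_lie_eq (x y z : Module.End ℂ V) : ⁅x * y, z⁆ = x * ⁅y, z⁆ + ⁅x, z⁆ * y := by
  simp only [Ring.lie_def]
  noncomm_ring

lemma lie_mul_eq (x y z : Module.End ℂ V) : ⁅z, x * y⁆ = x * ⁅z, y⁆ + ⁅z, x⁆ * y := by
  simp only [Ring.lie_def]
  noncomm_ring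

lemma lie_smul_eq (c : ℂ) (x y : Module.End ℂ V) : ⁅x, c • y⁆ = c • ⁅x, y⁆ := by
  simp only [Ring.lie_def, mul_smul_comm, smul_mul_assoc, smul_sub]

lemma smul_lie_eq (c : ℂ) (x y : Module.End ℂ V) : ⁅c • x, y⁆ = c • ⁅x, y⁆ := by
  simp only [Ring.lie_def, mul_smul_comm, smul_mul_assoc, smul_sub]

lemma mul_comm_of_lie_eq_zero {x y : Module.End ℂ V} (h : ⁅x, y⁆ = 0) : x * y = y * x :=
  sub_eq_zero.mp h

/-- Telescoping of the difference of a step function and its translate. -/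
lemma finsum_step_sub (c : ℤ) :
    ∑ᶠ s : ℤ, ((if 0 ≤ s + c then (1 : ℂ) else 0) - if 0 ≤ s then 1 else 0) = c := by
  rcases le_total 0 c with hc | hc
  · rw [finsum_eq_sum_of_support_subset (s := Finset.Ico (-c) 0)]
    · rw [Finset.sum_congr rfl (g := fun _ => (1 : ℂ))]
      · have : (c.toNat : ℂ) = c := by rw [← Int.cast_natCast, Int.toNat_of_nonneg hc]
        simpa using this
      · intro s hs
        rw [Finset.mem_Ico] at hs
        rw [if_pos (by omega), if_neg (by omega), sub_zero]
    · intro s hs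
      by_contra h
      simp only [Finset.coe_Ico, Set.mem_Ico, not_and, not_lt] at h
      apply hs
      by_cases h0 : 0 ≤ s
      · simp [h0, show 0 ≤ s + c by omega]
      · simp [h0, show ¬ 0 ≤ s + c by omega]
  · rw [finsum_eq_sum_of_support_subset (s := Finset.Ico 0 (-c))]
    · rw [Finset.sum_congr rfl (g := fun _ => (-1 : ℂ))]
      · have : (((-c).toNat : ℤ) : ℂ) = ((-c : ℤ) : ℂ) := by
          rw [Int.toNat_of_nonneg (by omega)]
        push_cast at this
        simp [this]
      · intro s hs
        rw [Finset.mem_Ico] at hs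
        rw [if_neg (by omega), if_pos (by omega), zero_sub]
    · intro s hs
      by_contra h
      simp only [Finset.coe_Ico, Set.mem_Ico, not_and, not_lt] at h
      apply hs
      by_cases h0 : 0 ≤ s
      · simp [h0, show 0 ≤ s + c by omega]
      · simp [h0, show ¬ 0 ≤ s + c by omega]

end LocallyFinite

/-! ### Multiplication and differentiation operators -/

section Elementary

open Filter

variable {σ : Type*}

/-- The partial derivative as an element of the endomorphism ring. -/
noncomputable def dEnd (v : σ) : Module.End ℂ (MvPolynomial σ ℂ) := (pderiv v).toLinearMap

/-- Multiplication by a polynomial as an element of the endomorphism ring. -/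
noncomputable def mEnd (f : MvPolynomial σ ℂ) : Module.End ℂ (MvPolynomial σ ℂ) :=
  LinearMap.mulLeft ℂ f

lemma dEnd_apply (v : σ) (q : MvPolynomial σ ℂ) : dEnd v q = pderiv v q := rfl

lemma mEnd_apply (f q : MvPolynomial σ ℂ) : mEnd f q = f * q := rfl

lemma lie_mEnd_mEnd (f g : MvPolynomial σ ℂ) : ⁅mEnd f, mEnd g⁆ = 0 := by
  refine LinearMap.ext fun q => ?_
  simp only [Ring.lie_def, LinearMap.sub_apply, Module.End.mul_apply, mEnd_apply,
    LinearMap.zero_apply]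
  ring

lemma lie_dEnd_dEnd (v w : σ) : ⁅dEnd v, dEnd w⁆ = 0 := by
  classical
  have h : ⁅pderiv (R := ℂ) v, pderiv (R := ℂ) w⁆ = 0 := by
    refine derivation_ext fun i => ?_
    rw [Derivation.commutator_apply]
    simp [pderiv_X, Pi.single_apply, apply_ite (pderiv (R := ℂ) _)]
  refine LinearMap.ext fun q => ?_
  exact DFunLike.congr_fun h q

lemma lie_dEnd_mEnd (v : σ) (f : MvPolynomial σ ℂ) : ⁅dEnd v, mEnd f⁆ = mEnd (pderiv v f) := by
  refine LinearMap.ext fun q => ?_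
  simp only [Ring.lie_def, LinearMap.sub_apply, Module.End.mul_apply, mEnd_apply, dEnd_apply,
    pderiv_mul]
  ring

lemma lie_dEnd_X_of_ne {v w : σ} (h : w ≠ v) : ⁅dEnd v, mEnd (X w)⁆ = 0 := by
  rw [lie_dEnd_mEnd, pderiv_X_of_ne h]
  refine LinearMap.ext fun q => ?_
  simp [mEnd_apply]

lemma lie_dEnd_X_self (v : σ) : ⁅dEnd v, mEnd (X v)⁆ = 1 := by
  rw [lie_dEnd_mEnd, pderiv_X_self]
  refine LinearMap.ext fun q => ?_
  simp [mEnd_apply]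

lemma eventually_dEnd_eq_zero {f : ℤ → σ} (hf : Function.Injective f) (q : MvPolynomial σ ℂ) :
    ∀ᶠ s in cofinite, dEnd (f s) q = 0 := by
  have h : ∀ᶠ v in cofinite, dEnd v q = 0 :=
    q.vars.finite_toSet.subset fun v hv => by
      by_contra hv'
      exact hv (pderiv_eq_zero_of_notMem_vars hv')
  exact hf.tendsto_cofinite.eventually h

end Elementary

/-! ### The free field modes as endomorphisms -/

section Modes

open Filter

variable (n r : ℕ)

/-- The linear version of `aop`. -/
noncomputable def aEnd (i j : ℕ) (m : ℤ) : Module.End ℂ (FSp n) :=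
  if h : 1 ≤ i ∧ i ≤ j ∧ j ≤ n then
    (if 0 ≤ m ∧ j ≤ r then dEnd (Sum.inl (⟨(i, j), h⟩, m))
     else mEnd (X (Sum.inl (⟨(i, j), h⟩, m))))
  else 0

/-- The linear version of `astarop`. -/
noncomputable def asEnd (i j : ℕ) (m : ℤ) : Module.End ℂ (FSp n) :=
  if h : 1 ≤ i ∧ i ≤ j ∧ j ≤ n then
    (if m ≤ 0 ∧ j ≤ r then mEnd (X (Sum.inl (⟨(i, j), h⟩, -m)))
     else -dEnd (Sum.inl (⟨(i, j), h⟩, -m)))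
  else 0

/-- The linear version of `bop`. -/
noncomputable def bEnd (e : ℕ → ℕ → ℂ) (lam : ℕ → ℂ) (i : ℕ) (m : ℤ) :
    Module.End ℂ (FSp n) :=
  if h : 0 < m then
    (m : ℂ) • ∑ k : Fin n, e i (k.1 + 1) • dEnd (Sum.inr (k, ⟨m.toNat, by omega⟩))
  else if h' : m = 0 then lam i • 1
  else mEnd (yPoly n e i ⟨(-m).toNat, by omega⟩)

lemma aop_eq (i j : ℕ) (m : ℤ) : aop n r i j m = aEnd n r i j m := by
  unfold aop aEnd
  split_ifs <;> rfl

lemma astarop_eq (i j : ℕ) (m : ℤ) : astarop n r i j m = asEnd n r i j m := by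
  unfold astarop asEnd
  split_ifs <;> rfl

lemma bop_eq (e : ℕ → ℕ → ℂ) (lam : ℕ → ℂ) (i : ℕ) (m : ℤ) :
    bop n e lam i m = bEnd n e lam i m := by
  unfold bop bEnd
  split_ifs
  · ext1 q
    simp [LinearMap.sum_apply, dEnd_apply]
  · rfl
  · rfl

lemma inl_injective (i j : ℕ) (h : 1 ≤ i ∧ i ≤ j ∧ j ≤ n) :
    Function.Injective fun s : ℤ => (Sum.inl (⟨(i, j), h⟩, s) : XIdx n ⊕ YIdx n) :=
  fun s t hst => by simpa using hst

lemma inl_ne {i j k l : ℕ} {s t : ℤ} (h : 1 ≤ i ∧ i ≤ j ∧ j ≤ n) (h' : 1 ≤ k ∧ k ≤ l ∧ l ≤ n)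
    (hne : ¬ (i = k ∧ j = l ∧ s = t)) :
    (Sum.inl (⟨(i, j), h⟩, s) : XIdx n ⊕ YIdx n) ≠ Sum.inl (⟨(k, l), h'⟩, t) := by
  intro he
  simp only [Sum.inl.injEq, Prod.mk.injEq, Subtype.mk.injEq] at he
  tauto

lemma lie_aEnd_aEnd (i j k l : ℕ) (s t : ℤ) : ⁅aEnd n r i j s, aEnd n r k l t⁆ = 0 := by
  unfold aEnd
  split_ifs with h1 h2 h3 h4 h5 h6
  · exact lie_dEnd_dEnd _ _
  · exact lie_dEnd_X_of_ne (inl_ne n _ _ (by rintro ⟨rfl, rfl, rfl⟩; exact h4 h2))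
  · simp
  · rw [← lie_skew, lie_dEnd_X_of_ne (inl_ne n _ _ (by rintro ⟨rfl, rfl, rfl⟩; exact h2 h6)),
      neg_zero]
  · exact lie_mEnd_mEnd _ _
  all_goals simp

lemma lie_asEnd_asEnd (i j k l : ℕ) (s t : ℤ) : ⁅asEnd n r i j s, asEnd n r k l t⁆ = 0 := by
  unfold asEnd
  split_ifs with h1 h2 h3 h4 h5 h6
  · exact lie_mEnd_mEnd _ _
  · rw [lie_neg, ← lie_skew, lie_dEnd_X_of_ne (inl_ne n _ _ ?_), neg_zero, neg_zero]
    rintro ⟨rfl, rfl, hst⟩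
    exact h4 ⟨by omega, h2.2⟩
  · simp
  · rw [neg_lie, lie_dEnd_X_of_ne (inl_ne n _ _ ?_), neg_zero]
    rintro ⟨rfl, rfl, hst⟩
    exact h2 ⟨by omega, h6.2⟩
  · rw [neg_lie, lie_neg, lie_dEnd_dEnd]
    simp
  all_goals simp

lemma lie_aEnd_asEnd_of_ne {i j k l : ℕ} {s t : ℤ} (hne : ¬ (i = k ∧ j = l ∧ s + t = 0)) :
    ⁅aEnd n r i j s, asEnd n r k l t⁆ = 0 := by
  unfold aEnd asEnd
  split_ifs with h1 h2 h3 h4 h5 h6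
  · exact lie_dEnd_X_of_ne (inl_ne n _ _ fun h => hne ⟨h.1.symm, h.2.1.symm, by omega⟩)
  · rw [lie_neg, lie_dEnd_dEnd, neg_zero]
  · simp
  · exact lie_mEnd_mEnd _ _
  · rw [lie_neg, ← lie_skew, lie_dEnd_X_of_ne (inl_ne n _ _ fun h => hne ⟨h.1, h.2.1, by omega⟩)]
    simp
  all_goals simp

lemma lie_aEnd_asEnd_self {i j : ℕ} {s t : ℤ} (h : 1 ≤ i ∧ i ≤ j ∧ j ≤ n) (hst : s + t = 0) :
    ⁅aEnd n r i j s, asEnd n r i j t⁆ = 1 := by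
  obtain rfl : t = -s := by omega
  unfold aEnd asEnd
  rw [dif_pos h, dif_pos h, neg_neg]
  by_cases hs : 0 ≤ s ∧ j ≤ r
  · rw [if_pos hs, if_pos ⟨by omega, hs.2⟩, lie_dEnd_X_self]
  · rw [if_neg hs, if_neg (by omega), lie_neg, lie_skew, lie_dEnd_X_self]

lemma lie_dEnd_inl_bEnd (e : ℕ → ℕ → ℂ) (lam : ℕ → ℂ) (i : ℕ) (m : ℤ) (v : XIdx n) :
    ⁅dEnd (Sum.inl v : XIdx n ⊕ YIdx n), bEnd n e lam i m⁆ = 0 := by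
  unfold bEnd
  split_ifs
  · simp only [lie_smul_eq, lie_sum, lie_dEnd_dEnd, smul_zero, Finset.sum_const_zero]
  · simp [Ring.lie_def]
  · rw [lie_dEnd_mEnd]
    refine LinearMap.ext fun q => ?_
    simp [yPoly, mEnd_apply]

lemma lie_mEnd_inl_bEnd (e : ℕ → ℕ → ℂ) (lam : ℕ → ℂ) (i : ℕ) (m : ℤ) (v : XIdx n) :
    ⁅mEnd (X (Sum.inl v : XIdx n ⊕ YIdx n)), bEnd n e lam i m⁆ = 0 := by
  unfold bEnd
  split_ifs
  · simp only [lie_smul_eq, lie_sum]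
    refine smul_eq_zero_of_right _ (Finset.sum_eq_zero fun k _ => ?_)
    rw [← lie_skew, lie_dEnd_X_of_ne (by simp), neg_zero, smul_zero]
  · simp [Ring.lie_def]
  · exact lie_mEnd_mEnd _ _

lemma lie_bEnd_aEnd (e : ℕ → ℕ → ℂ) (lam : ℕ → ℂ) (i k l : ℕ) (m s : ℤ) :
    ⁅bEnd n e lam i m, aEnd n r k l s⁆ = 0 := by
  rw [← lie_skew, neg_eq_zero]
  unfold aEnd
  split_ifs
  · exact lie_dEnd_inl_bEnd ..
  · exact lie_mEnd_inl_bEnd ..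
  · simp

lemma lie_bEnd_asEnd (e : ℕ → ℕ → ℂ) (lam : ℕ → ℂ) (i k l : ℕ) (m s : ℤ) :
    ⁅bEnd n e lam i m, asEnd n r k l s⁆ = 0 := by
  rw [← lie_skew, neg_eq_zero]
  unfold asEnd
  split_ifs
  · exact lie_mEnd_inl_bEnd ..
  · rw [neg_lie, lie_dEnd_inl_bEnd, neg_zero]
  · simp

variable {n r}

lemma aEnd_top {i j : ℕ} (hj : j ≤ r) (q : FSp n) : ∀ᶠ s in atTop, aEnd n r i j s q = 0 := by
  unfold aEnd
  by_cases h : 1 ≤ i ∧ i ≤ j ∧ j ≤ n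
  · have := eventually_dEnd_eq_zero (inl_injective n i j h) q
    rw [Int.cofinite_eq, eventually_sup] at this
    filter_upwards [this.2, eventually_ge_atTop 0] with s hs h0
    rw [dif_pos h, if_pos ⟨h0, hj⟩, hs]
  · simp [h]

lemma asEnd_top {i j : ℕ} (q : FSp n) : ∀ᶠ s in atTop, asEnd n r i j s q = 0 := by
  unfold asEnd
  by_cases h : 1 ≤ i ∧ i ≤ j ∧ j ≤ n
  · have := eventually_dEnd_eq_zero ((inl_injective n i j h).comp neg_injective) q
    rw [Int.cofinite_eq, eventually_sup] at this
    filter_upwards [this.2, eventually_gt_atTop 0] with s hs h0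
    rw [dif_pos h, if_neg (by omega), LinearMap.neg_apply]
    exact neg_eq_zero.mpr hs
  · simp [h]

lemma asEnd_locFin {i j : ℕ} (hj : r < j) : LocFin (asEnd n r i j) := fun q => by
  unfold asEnd
  by_cases h : 1 ≤ i ∧ i ≤ j ∧ j ≤ n
  · filter_upwards [eventually_dEnd_eq_zero ((inl_injective n i j h).comp neg_injective) q]
      with s hs
    rw [dif_pos h, if_neg (by omega), LinearMap.neg_apply]
    exact neg_eq_zero.mpr hs
  · simp [h]

lemma bEnd_top (e : ℕ → ℕ → ℂ) (lam : ℕ → ℂ) (i : ℕ) (q : FSp n) :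
    ∀ᶠ s in atTop, bEnd n e lam i s q = 0 := by
  have h (k : Fin n) : ∀ᶠ s : ℕ in atTop, ∀ h : 1 ≤ s,
      dEnd (Sum.inr (k, ⟨s, h⟩) : XIdx n ⊕ YIdx n) q = 0 := by
    rw [← Nat.cofinite_eq_atTop]
    have hv : ∀ᶠ v in cofinite, dEnd v q = 0 :=
      q.vars.finite_toSet.subset fun v hv => by
        by_contra hv'
        exact hv (pderiv_eq_zero_of_notMem_vars hv')
    have hinj : Function.Injective
        fun s : {m : ℕ // 1 ≤ m} => (Sum.inr (k, s) : XIdx n ⊕ YIdx n) :=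
      fun s t hst => by simpa using hst
    have := hinj.tendsto_cofinite.eventually hv
    rw [eventually_cofinite] at this ⊢
    refine (this.image Subtype.val).subset fun s hs => ?_
    simp only [Set.mem_ofPred_eq, not_forall] at hs
    obtain ⟨h1, h2⟩ := hs
    exact ⟨⟨s, h1⟩, h2, rfl⟩
  have h2 := tendsto_atTop_mono (fun s : ℤ => Int.self_le_toNat s) tendsto_id
  have h3 : Tendsto Int.toNat atTop atTop := by
    rw [← tendsto_natCast_atTop_iff (R := ℤ)]
    exact h2
  filter_upwards [h3.eventually (eventually_all.mpr h), eventually_gt_atTop 0] with s hs h0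
  unfold bEnd
  rw [dif_pos h0]
  simp [LinearMap.sum_apply, hs]

end Modes

/-! ### Quadratic and cubic fields -/

section Fields

open Filter

variable (n r : ℕ)

lemma aEnd_comm_asEnd {i j k l : ℕ} (s t : ℤ) (hne : (i, j) ≠ (k, l)) :
    aEnd n r i j s * asEnd n r k l t = asEnd n r k l t * aEnd n r i j s :=
  mul_comm_of_lie_eq_zero (lie_aEnd_asEnd_of_ne n r fun h => hne (by rw [h.1, h.2.1]))

/-- Mode `M` of the product of `a_{ij}` and `a*_{kl}` without normal ordering. -/
noncomputable def prodMode (i j k l : ℕ) (M : ℤ) : Module.End ℂ (FSp n) :=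
  lsum fun s => aEnd n r i j s * asEnd n r k l (M - s)

/-- The linear version of the normally ordered pair `nAA` with equal indices. -/
noncomputable def nEnd (i j : ℕ) (u v : ℤ) : Module.End ℂ (FSp n) :=
  if 0 ≤ u ∧ j ≤ r then asEnd n r i j v * aEnd n r i j u
  else aEnd n r i j u * asEnd n r i j v

/-- The linear version of `nAAmode` with equal indices. -/
noncomputable def nMode (i j : ℕ) (M : ℤ) : Module.End ℂ (FSp n) :=
  lsum fun s => nEnd n r i j s (M - s)

/-- The quadratic field occurring in the cubic part of `ρ(E_i)`. -/
noncomputable def quadMode (i : ℕ) (M : ℤ) : Module.End ℂ (FSp n) :=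
  ∑ k ∈ Finset.Ico 1 i, nMode n r k (i - 1) M - ∑ k ∈ Finset.Icc 1 i, nMode n r k i M

/-- The linear version of `nStar`. -/
noncomputable def starEnd (i j : ℕ) (s : ℤ) (B : Module.End ℂ (FSp n)) :
    Module.End ℂ (FSp n) :=
  if (j ≤ r ∧ 0 < s) ∨ r < j then B * asEnd n r i j s else asEnd n r i j s * B

/-- The linear version of `rhoF`. -/
noncomputable def fEnd (j : ℕ) (p : ℤ) : Module.End ℂ (FSp n) :=
  aEnd n r j j p + ∑ l ∈ Finset.Icc (j + 1) n, prodMode n r j l (j + 1) l p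

/-- The linear version of `rhoH`. -/
noncomputable def hEnd (e : ℕ → ℕ → ℂ) (lam : ℕ → ℂ) (i : ℕ) (m : ℤ) :
    Module.End ℂ (FSp n) :=
  (2 : ℂ) • nMode n r i i m
    + ∑ j ∈ Finset.Ico 1 i, (nMode n r j i m - nMode n r j (i - 1) m)
    + ∑ j ∈ Finset.Icc (i + 1) n, (nMode n r i j m - nMode n r (i + 1) j m)
    + bEnd n e lam i m

/-- The linear version of `rhoE`. -/
noncomputable def eEnd (γ : ℂ) (e : ℕ → ℕ → ℂ) (lam : ℕ → ℂ) (i : ℕ) (m : ℤ) :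
    Module.End ℂ (FSp n) :=
  lsum (fun s => starEnd n r i i s (quadMode n r i (m - s)))
    + ∑ k ∈ Finset.Icc (i + 1) n, prodMode n r (i + 1) k i k m
    - ∑ k ∈ Finset.Ico 1 i, prodMode n r k (i - 1) k i m
    - lsum (fun s => asEnd n r i i s * bEnd n e lam i (m - s))
    - ((if r < i then (r : ℂ) + 1 else (i : ℂ) + 1) - γ ^ 2) •
        ((-(m : ℂ)) • asEnd n r i i m)

variable {n r}

lemma tendsto_const_sub_atBot (M : ℤ) : Tendsto (fun s : ℤ => M - s) atBot atTop :=
  tendsto_atTop_add_const_left _ M tendsto_neg_atBot_atTop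

lemma prodMode_locFin {i j k l : ℕ} (hne : (i, j) ≠ (k, l)) (hjl : j ≤ l) (M : ℤ) :
    LocFin fun s => aEnd n r i j s * asEnd n r k l (M - s) := by
  rcases lt_or_ge r l with hl | hl
  · intro q
    have hinj : Function.Injective fun s : ℤ => M - s := sub_right_injective
    filter_upwards [hinj.tendsto_cofinite.eventually (asEnd_locFin (i := k) hl q)] with s hs
    rw [Module.End.mul_apply, hs, map_zero]
  · refine locFin_of_top_bot (fun q => ?_) fun q => ?_
    · filter_upwards [aEnd_top (n := n) (i := i) (hjl.trans hl) q] with s hs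
      rw [aEnd_comm_asEnd n r _ _ hne, Module.End.mul_apply, hs, map_zero]
    · filter_upwards [(tendsto_const_sub_atBot M).eventually
        (asEnd_top (n := n) (r := r) (i := k) (j := l) q)] with s hs
      rw [Module.End.mul_apply, hs, map_zero]

lemma nEnd_locFin (i j : ℕ) (M : ℤ) : LocFin fun s => nEnd n r i j s (M - s) := by
  unfold nEnd
  rcases lt_or_ge r j with hl | hl
  · intro q
    have hinj : Function.Injective fun s : ℤ => M - s := sub_right_injective
    filter_upwards [hinj.tendsto_cofinite.eventually (asEnd_locFin (i := i) hl q)] with s hs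
    rw [if_neg (by omega), Module.End.mul_apply, hs, map_zero]
  · refine locFin_of_top_bot (fun q => ?_) fun q => ?_
    · filter_upwards [aEnd_top (n := n) (i := i) hl q, eventually_ge_atTop 0] with s hs h0
      rw [if_pos ⟨h0, hl⟩, Module.End.mul_apply, hs, map_zero]
    · filter_upwards [(tendsto_const_sub_atBot M).eventually
        (asEnd_top (n := n) (r := r) (i := i) (j := j) q), eventually_lt_atBot 0] with s hs h0
      rw [if_neg (by omega), Module.End.mul_apply, hs, map_zero]

lemma nMode_top {i j : ℕ} (hj : j ≤ r) (q : FSp n) : ∀ᶠ M in atTop, nMode n r i j M q = 0 := by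
  obtain ⟨U, hU⟩ := eventually_atTop.mp (aEnd_top (n := n) (i := i) hj q)
  obtain ⟨W, hW⟩ := eventually_atTop.mp (asEnd_top (n := n) (r := r) (i := i) (j := j) q)
  filter_upwards [eventually_ge_atTop 1, eventually_ge_atTop W, eventually_ge_atTop (W + U)]
    with M h1 h2 h3
  rw [nMode, lsum_apply (nEnd_locFin i j M)]
  refine finsum_eq_zero_of_forall_eq_zero fun s => ?_
  unfold nEnd
  split_ifs with hs
  · rcases le_total U s with h | h
    · rw [Module.End.mul_apply, hU s h, map_zero]
    · rw [← mul_comm_of_lie_eq_zero (lie_aEnd_asEnd_of_ne n r (by omega)),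
        Module.End.mul_apply, hW _ (by omega), map_zero]
  · rw [Module.End.mul_apply, hW _ (by omega), map_zero]

lemma quadMode_top {i : ℕ} (hi : i ≤ r) (q : FSp n) :
    ∀ᶠ M in atTop, quadMode n r i M q = 0 := by
  have h1 : ∀ᶠ M in atTop, ∀ k ∈ Finset.Ico 1 i, nMode n r k (i - 1) M q = 0 :=
    (eventually_all_finset _).mpr fun k _ => nMode_top (by omega) q
  have h2 : ∀ᶠ M in atTop, ∀ k ∈ Finset.Icc 1 i, nMode n r k i M q = 0 :=
    (eventually_all_finset _).mpr fun k _ => nMode_top hi q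
  filter_upwards [h1, h2] with M h1 h2
  rw [quadMode, LinearMap.sub_apply, LinearMap.sum_apply, LinearMap.sum_apply,
    Finset.sum_eq_zero h1, Finset.sum_eq_zero h2, sub_zero]

lemma starEnd_locFin {i j : ℕ} {B : ℤ → Module.End ℂ (FSp n)}
    (hB : j ≤ r → ∀ q, ∀ᶠ M in atTop, B M q = 0) (m : ℤ) :
    LocFin fun s => starEnd n r i j s (B (m - s)) := by
  unfold starEnd
  rcases lt_or_ge r j with hl | hl
  · intro q
    filter_upwards [asEnd_locFin (i := i) hl q] with s hs
    rw [if_pos (Or.inr hl), Module.End.mul_apply, hs, map_zero]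
  · refine locFin_of_top_bot (fun q => ?_) fun q => ?_
    · filter_upwards [asEnd_top (n := n) (r := r) (i := i) (j := j) q, eventually_gt_atTop 0]
        with s hs h0
      rw [if_pos (Or.inl ⟨hl, h0⟩), Module.End.mul_apply, hs, map_zero]
    · filter_upwards [(tendsto_const_sub_atBot m).eventually (hB hl q), eventually_lt_atBot 0]
        with s hs h0
      rw [if_neg (by omega), Module.End.mul_apply, hs, map_zero]

lemma asEnd_bEnd_comm (e : ℕ → ℕ → ℂ) (lam : ℕ → ℂ) (i k l : ℕ) (s t : ℤ) :
    asEnd n r k l s * bEnd n e lam i t = bEnd n e lam i t * asEnd n r k l s :=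
  (mul_comm_of_lie_eq_zero (lie_bEnd_asEnd n r e lam i k l t s)).symm

lemma asEnd_bEnd_locFin (e : ℕ → ℕ → ℂ) (lam : ℕ → ℂ) (i k l : ℕ) (m : ℤ) :
    LocFin fun s => asEnd n r k l s * bEnd n e lam i (m - s) := by
  refine locFin_of_top_bot (fun q => ?_) fun q => ?_
  · filter_upwards [asEnd_top (n := n) (r := r) (i := k) (j := l) q] with s hs
    rw [asEnd_bEnd_comm, Module.End.mul_apply, hs, map_zero]
  · filter_upwards [(tendsto_const_sub_atBot m).eventually (bEnd_top e lam i q)] with s hs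
    rw [Module.End.mul_apply, hs, map_zero]

/-! ### The function-level operators are the linear ones -/

lemma nAAmode_eq (i j : ℕ) (M : ℤ) : nAAmode n r i j i j M = nMode n r i j M := by
  ext1 q
  rw [nAAmode, nMode, lsum_apply (nEnd_locFin i j M)]
  refine finsum_congr fun s => ?_
  unfold nAA nEnd
  split_ifs <;> simp only [aop_eq, astarop_eq, Module.End.mul_apply]

lemma prodMode_apply {i j k l : ℕ} (hne : (i, j) ≠ (k, l)) (hjl : j ≤ l) (M : ℤ) (q : FSp n) :
    prodMode n r i j k l M q = ∑ᶠ s : ℤ, aop n r i j s (astarop n r k l (M - s) q) := by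
  rw [prodMode, lsum_apply (prodMode_locFin hne hjl M)]
  simp only [aop_eq, astarop_eq, Module.End.mul_apply]

lemma rhoF_eq (j : ℕ) (p : ℤ) : rhoF n r j p = fEnd n r j p := by
  ext1 q
  rw [rhoF, fEnd, LinearMap.add_apply, LinearMap.sum_apply, aop_eq]
  congr 1
  exact Finset.sum_congr rfl fun l _ => (prodMode_apply (by simp) le_rfl p q).symm

lemma rhoH_eq (e : ℕ → ℕ → ℂ) (lam : ℕ → ℂ) (i : ℕ) (m : ℤ) :
    rhoH n r e lam i m = hEnd n r e lam i m := by
  ext1 q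
  simp only [rhoH, hEnd, LinearMap.add_apply, LinearMap.sub_apply, LinearMap.smul_apply,
    LinearMap.sum_apply, nAAmode_eq, bop_eq]

lemma rhoE_eq (γ : ℂ) (e : ℕ → ℕ → ℂ) (lam : ℕ → ℂ) {i : ℕ} (hi : 1 ≤ i) (m : ℤ) :
    rhoE n r γ e lam i m = eEnd n r γ e lam i m := by
  ext1 q
  simp only [rhoE, eEnd, LinearMap.add_apply, LinearMap.sub_apply, LinearMap.smul_apply,
    LinearMap.sum_apply]
  rw [lsum_apply (starEnd_locFin quadMode_top m), lsum_apply (asEnd_bEnd_locFin e lam i i i m),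
    astarop_eq]
  congr 2
  · congr 1
    · congr 1
      · refine finsum_congr fun s => ?_
        unfold nStar starEnd quadMode
        split_ifs <;>
        simp [Finset.sum_apply, LinearMap.sum_apply, nAAmode_eq, astarop_eq]
      · exact Finset.sum_congr rfl fun k _ => (prodMode_apply (by simp) le_rfl m q).symm
    · refine Finset.sum_congr rfl fun k _ => (prodMode_apply ?_ (by omega) m q).symm
      rw [Ne, Prod.mk.injEq]
      omega
  · simp only [astarop_eq, bop_eq, Module.End.mul_apply]

end Fields

/-! ### Commutators with `ρ(F_j)` -/

section Commutators

variable {n r : ℕ}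

lemma lie_asEnd_aEnd_of_ne {i j k l : ℕ} {s t : ℤ} (hne : ¬ (i = k ∧ j = l ∧ s + t = 0)) :
    ⁅asEnd n r i j s, aEnd n r k l t⁆ = 0 := by
  rw [← lie_skew, lie_aEnd_asEnd_of_ne n r (by omega), neg_zero]

lemma lie_asEnd_aEnd_self {i j : ℕ} {s t : ℤ} (h : 1 ≤ i ∧ i ≤ j ∧ j ≤ n) (hst : s + t = 0) :
    ⁅asEnd n r i j s, aEnd n r i j t⁆ = -1 := by
  rw [← lie_skew, lie_aEnd_asEnd_self n r h (by omega)]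

lemma lie_aEnd_prodMode_of_ne {j k l l' : ℕ} (hne : ¬ (k = j + 1 ∧ l = l')) (s p : ℤ) :
    ⁅aEnd n r k l s, prodMode n r j l' (j + 1) l' p⁆ = 0 := by
  rw [prodMode, lie_lsum (prodMode_locFin (by simp) le_rfl p)]
  simp only [lie_mul_eq, lie_aEnd_aEnd,
    lie_aEnd_asEnd_of_ne n r fun h => hne ⟨h.1, h.2.1⟩, mul_zero, zero_mul, add_zero, lsum_zero]

lemma lie_aEnd_prodMode_self {j l : ℕ} (hj : j + 1 ≤ l) (hl : l ≤ n) (s p : ℤ) :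
    ⁅aEnd n r (j + 1) l s, prodMode n r j l (j + 1) l p⁆ = aEnd n r j l (s + p) := by
  rw [prodMode, lie_lsum (prodMode_locFin (by simp) le_rfl p), lsum_eq_single (s + p)]
  · rw [lie_mul_eq, lie_aEnd_aEnd, lie_aEnd_asEnd_self n r (by omega) (by omega), mul_one,
      zero_mul, add_zero]
  · intro t ht
    rw [lie_mul_eq, lie_aEnd_aEnd, lie_aEnd_asEnd_of_ne n r (by omega), mul_zero, zero_mul,
      add_zero]

lemma lie_asEnd_prodMode_of_ne {j k l l' : ℕ} (hne : ¬ (k = j ∧ l = l')) (s p : ℤ) :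
    ⁅asEnd n r k l s, prodMode n r j l' (j + 1) l' p⁆ = 0 := by
  rw [prodMode, lie_lsum (prodMode_locFin (by simp) le_rfl p)]
  simp only [lie_mul_eq, lie_asEnd_asEnd, lie_asEnd_aEnd_of_ne fun h => hne ⟨h.1, h.2.1⟩,
    mul_zero, zero_mul, add_zero, lsum_zero]

lemma lie_asEnd_prodMode_self {j l : ℕ} (h : 1 ≤ j ∧ j ≤ l ∧ l ≤ n) (s p : ℤ) :
    ⁅asEnd n r j l s, prodMode n r j l (j + 1) l p⁆ = -asEnd n r (j + 1) l (s + p) := by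
  rw [prodMode, lie_lsum (prodMode_locFin (by simp) le_rfl p), lsum_eq_single (-s)]
  · rw [lie_mul_eq, lie_asEnd_asEnd, lie_asEnd_aEnd_self h (by omega), mul_zero, zero_add,
      end_neg_one_mul, sub_neg_eq_add, add_comm p]
  · intro t ht
    rw [lie_mul_eq, lie_asEnd_asEnd, lie_asEnd_aEnd_of_ne (by omega), mul_zero, zero_mul,
      add_zero]

lemma lie_aEnd_fEnd_of_ne {j k : ℕ} (hne : k ≠ j + 1) (l : ℕ) (s p : ℤ) :
    ⁅aEnd n r k l s, fEnd n r j p⁆ = 0 := by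
  rw [fEnd, lie_add, lie_aEnd_aEnd, lie_sum, zero_add]
  exact Finset.sum_eq_zero fun l' _ => lie_aEnd_prodMode_of_ne (fun h => hne h.1) s p

lemma lie_aEnd_fEnd_self {j l : ℕ} (hj : j + 1 ≤ l) (hl : l ≤ n) (s p : ℤ) :
    ⁅aEnd n r (j + 1) l s, fEnd n r j p⁆ = aEnd n r j l (s + p) := by
  rw [fEnd, lie_add, lie_aEnd_aEnd, lie_sum, zero_add,
    Finset.sum_eq_single_of_mem l (Finset.mem_Icc.mpr ⟨hj, hl⟩), lie_aEnd_prodMode_self hj hl]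
  exact fun l' _ hne => lie_aEnd_prodMode_of_ne (fun h => hne h.2.symm) s p

lemma lie_asEnd_fEnd_of_ne {j k : ℕ} (hne : k ≠ j) (l : ℕ) (s p : ℤ) :
    ⁅asEnd n r k l s, fEnd n r j p⁆ = 0 := by
  rw [fEnd, lie_add, lie_asEnd_aEnd_of_ne fun h => hne h.1, lie_sum, zero_add]
  exact Finset.sum_eq_zero fun l' _ => lie_asEnd_prodMode_of_ne (fun h => hne h.1) s p

lemma lie_asEnd_fEnd_diag {j : ℕ} (hj : 1 ≤ j) (hj' : j ≤ n) (s p : ℤ) :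
    ⁅asEnd n r j j s, fEnd n r j p⁆ = if s + p = 0 then -1 else 0 := by
  rw [fEnd, lie_add, lie_sum, Finset.sum_eq_zero, add_zero]
  · split_ifs with h
    · exact lie_asEnd_aEnd_self ⟨hj, le_rfl, hj'⟩ h
    · exact lie_asEnd_aEnd_of_ne fun h' => h h'.2.2
  · intro l hl
    rw [Finset.mem_Icc] at hl
    exact lie_asEnd_prodMode_of_ne (by omega) s p

lemma lie_asEnd_fEnd_offdiag {j l : ℕ} (hj : 1 ≤ j) (hjl : j + 1 ≤ l) (hl : l ≤ n) (s p : ℤ) :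
    ⁅asEnd n r j l s, fEnd n r j p⁆ = -asEnd n r (j + 1) l (s + p) := by
  rw [fEnd, lie_add, lie_asEnd_aEnd_of_ne (by omega), lie_sum, zero_add,
    Finset.sum_eq_single_of_mem l (Finset.mem_Icc.mpr ⟨hjl, hl⟩),
    lie_asEnd_prodMode_self ⟨hj, by omega, hl⟩]
  exact fun l' _ hne => lie_asEnd_prodMode_of_ne (fun h => hne h.2.symm) s p

lemma lie_bEnd_fEnd (e : ℕ → ℕ → ℂ) (lam : ℕ → ℂ) (i j : ℕ) (m p : ℤ) :
    ⁅bEnd n e lam i m, fEnd n r j p⁆ = 0 := by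
  rw [fEnd, lie_add, lie_bEnd_aEnd, lie_sum, zero_add]
  refine Finset.sum_eq_zero fun l _ => ?_
  rw [prodMode, lie_lsum (prodMode_locFin (by simp) le_rfl p)]
  simp only [lie_mul_eq, lie_bEnd_aEnd, lie_bEnd_asEnd, mul_zero, zero_mul, add_zero, lsum_zero]

lemma lie_nMode_fEnd_of_ne {j k : ℕ} (h : k ≠ j) (h' : k ≠ j + 1) (l : ℕ) (M p : ℤ) :
    ⁅nMode n r k l M, fEnd n r j p⁆ = 0 := by
  rw [nMode, lsum_lie (nEnd_locFin k l M)]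
  convert lsum_zero using 2
  funext s
  unfold nEnd
  split_ifs <;>
  simp [mul_lie_eq, lie_aEnd_fEnd_of_ne h', lie_asEnd_fEnd_of_ne h]

lemma lie_nMode_fEnd_succ {j l : ℕ} (hj : j + 1 ≤ l) (hl : l ≤ n) (M p : ℤ) :
    ⁅nMode n r (j + 1) l M, fEnd n r j p⁆ = prodMode n r j l (j + 1) l (M + p) := by
  rw [nMode, lsum_lie (nEnd_locFin _ l M), prodMode,
    ← lsum_shift (prodMode_locFin (by simp) le_rfl (M + p)) p]
  congr 1
  funext s
  unfold nEnd
  rw [show M + p - (s + p) = M - s by ring]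
  split_ifs <;>
  rw [mul_lie_eq, lie_aEnd_fEnd_self hj hl, lie_asEnd_fEnd_of_ne (by omega)] <;>
  simp [aEnd_comm_asEnd n r (i := j) (k := j + 1)]

lemma lie_nMode_fEnd_offdiag {j l : ℕ} (hj : 1 ≤ j) (hjl : j + 1 ≤ l) (hl : l ≤ n) (M p : ℤ) :
    ⁅nMode n r j l M, fEnd n r j p⁆ = -prodMode n r j l (j + 1) l (M + p) := by
  rw [nMode, lsum_lie (nEnd_locFin _ l M), prodMode,
    ← lsum_neg (prodMode_locFin (by simp) le_rfl (M + p))]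
  congr 1
  funext s
  unfold nEnd
  rw [show M + p - s = M - s + p by ring]
  split_ifs <;>
  rw [mul_lie_eq, lie_aEnd_fEnd_of_ne (by omega), lie_asEnd_fEnd_offdiag hj hjl hl] <;>
  simp [end_neg_mul, end_mul_neg, aEnd_comm_asEnd n r (i := j) (k := j + 1)]

lemma lie_nMode_fEnd_diag {j : ℕ} (hj : 1 ≤ j) (hj' : j ≤ n) (M p : ℤ) :
    ⁅nMode n r j j M, fEnd n r j p⁆ = -aEnd n r j j (M + p) := by
  have key (s : ℤ) : ⁅nEnd n r j j s (M - s), fEnd n r j p⁆ =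
      if M - s + p = 0 then -aEnd n r j j s else 0 := by
    unfold nEnd
    split_ifs with h1 h2 h2 <;>
    rw [mul_lie_eq, lie_aEnd_fEnd_of_ne (by omega), lie_asEnd_fEnd_diag hj hj'] <;>
    simp [h2, end_neg_one_mul, end_mul_neg_one]
  rw [nMode, lsum_lie (nEnd_locFin _ j M), lsum_eq_single (M + p)]
  · rw [key, if_pos (by omega)]
  · intro s hs
    rw [key, if_neg (by omega)]

lemma sum_lie_nMode_fEnd {j l : ℕ} (hj : 1 ≤ j) (hl : l ≤ n) (M p : ℤ) :
    ∑ k ∈ Finset.Icc 1 l, ⁅nMode n r k l M, fEnd n r j p⁆ =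
      if l = j then -aEnd n r j j (M + p) else 0 := by
  rcases lt_trichotomy l j with h | rfl | h
  · rw [if_neg h.ne]
    refine Finset.sum_eq_zero fun k hk => ?_
    rw [Finset.mem_Icc] at hk
    exact lie_nMode_fEnd_of_ne (by omega) (by omega) l M p
  · rw [if_pos rfl, Finset.sum_eq_single_of_mem l (Finset.mem_Icc.mpr ⟨hj, le_rfl⟩),
      lie_nMode_fEnd_diag hj hl]
    intro k hk hne
    rw [Finset.mem_Icc] at hk
    exact lie_nMode_fEnd_of_ne hne (by omega) l M p
  · rw [if_neg h.ne', Finset.sum_eq_add_of_mem j (j + 1) (Finset.mem_Icc.mpr ⟨hj, h.le⟩)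
      (Finset.mem_Icc.mpr ⟨by omega, h⟩) (by omega),
      lie_nMode_fEnd_succ h hl, lie_nMode_fEnd_offdiag hj h hl, neg_add_cancel]
    intro k _ hk
    exact lie_nMode_fEnd_of_ne hk.1 hk.2 l M p

lemma lie_quadMode_fEnd {i j : ℕ} (hi : i ≤ n) (hj : 1 ≤ j) (M p : ℤ) :
    ⁅quadMode n r i M, fEnd n r j p⁆ =
      (if i - 1 = j then -aEnd n r j j (M + p) else 0)
        - if i = j then -aEnd n r j j (M + p) else 0 := by
  rw [quadMode, sub_lie, sum_lie, sum_lie, sum_lie_nMode_fEnd hj hi]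
  congr 1
  rw [← sum_lie_nMode_fEnd hj (by omega : i - 1 ≤ n)]
  refine Finset.sum_congr ?_ fun _ _ => rfl
  ext k
  simp only [Finset.mem_Ico, Finset.mem_Icc]
  omega

/-- Normal ordering of `a*_{ii}` against `a_{ii}` agrees with that of `a_{ii}` against
`a*_{ii}`. -/
lemma starEnd_aEnd (i : ℕ) (M s : ℤ) :
    starEnd n r i i s (aEnd n r i i (M - s)) = nEnd n r i i (M - s) s := by
  unfold starEnd nEnd
  split_ifs with h1 h2 h2
  · exact mul_comm_of_lie_eq_zero (lie_aEnd_asEnd_of_ne n r (by omega))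
  · rfl
  · rfl
  · exact mul_comm_of_lie_eq_zero (lie_asEnd_aEnd_of_ne (by omega))

lemma lsum_starEnd_aEnd (i : ℕ) (M : ℤ) :
    lsum (fun s => starEnd n r i i s (aEnd n r i i (M - s))) = nMode n r i i M := by
  rw [nMode, ← lsum_reflect (nEnd_locFin i i M) M]
  simp only [starEnd_aEnd, sub_sub_cancel]

lemma lie_starEnd_of_lie_eq_zero {i : ℕ} {s : ℤ} {B G : Module.End ℂ (FSp n)}
    (h : ⁅asEnd n r i i s, G⁆ = 0) :
    ⁅starEnd n r i i s B, G⁆ = starEnd n r i i s ⁅B, G⁆ := by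
  unfold starEnd
  split_ifs <;> simp [mul_lie_eq, h]

lemma lie_cubic_fEnd_self {i : ℕ} (hi : 1 ≤ i) (hi' : i ≤ n) (m p : ℤ) :
    ⁅lsum (fun s => starEnd n r i i s (quadMode n r i (m - s))), fEnd n r i p⁆ =
      nMode n r i i (m + p) - quadMode n r i (m + p) := by
  have hloc := starEnd_locFin (r := r) (i := i) (j := i) (B := quadMode n r i) quadMode_top m
  have key (s : ℤ) : ⁅starEnd n r i i s (quadMode n r i (m - s)), fEnd n r i p⁆ =
      starEnd n r i i s (aEnd n r i i (m + p - s))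
        + if s + p = 0 then -quadMode n r i (m - s) else 0 := by
    have hB : ⁅quadMode n r i (m - s), fEnd n r i p⁆ = aEnd n r i i (m + p - s) := by
      rw [lie_quadMode_fEnd hi' hi, if_neg (by omega), if_pos rfl, zero_sub, neg_neg]
      congr 1
      ring
    unfold starEnd
    split_ifs with h1 h2 h2 <;>
    rw [mul_lie_eq, hB, lie_asEnd_fEnd_diag hi hi'] <;>
    simp [h2, end_neg_one_mul, end_mul_neg_one]
    all_goals abel
  have hs : LocFin fun s : ℤ => if s + p = 0 then -quadMode n r i (m - s) else 0 :=
    locFin_of_eq_zero (-p) fun s hs => if_neg (by omega)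
  have ha : LocFin fun s : ℤ => starEnd n r i i s (aEnd n r i i (m + p - s)) :=
    starEnd_locFin (fun h q => aEnd_top h q) (m + p)
  rw [lsum_lie hloc]
  simp only [key]
  rw [lsum_add ha hs, lsum_starEnd_aEnd, lsum_eq_single (-p), if_pos (by omega),
    sub_neg_eq_add, sub_eq_add_neg]
  exact fun s hs => if_neg (by omega)

lemma lie_cubic_fEnd_of_ne {i j : ℕ} (hi' : i ≤ n) (hj : 1 ≤ j) (hij : i ≠ j)
    (m p : ℤ) :
    ⁅lsum (fun s => starEnd n r i i s (quadMode n r i (m - s))), fEnd n r j p⁆ =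
      if j + 1 = i then -prodMode n r j j i i (m + p) else 0 := by
  have hloc := starEnd_locFin (r := r) (i := i) (j := i) (B := quadMode n r i) quadMode_top m
  rw [lsum_lie hloc]
  split_ifs with h
  · have hp : LocFin fun s => aEnd n r j j s * asEnd n r i i (m + p - s) :=
      prodMode_locFin (by simp only [ne_eq, Prod.mk.injEq]; omega) (by omega) _
    rw [prodMode, ← lsum_neg hp, ← lsum_reflect hp.neg (m + p)]
    congr 1
    funext s
    rw [lie_starEnd_of_lie_eq_zero (lie_asEnd_fEnd_of_ne hij i s p), lie_quadMode_fEnd hi' hj,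
      if_pos (by omega), if_neg hij, sub_zero, sub_sub_cancel,
      show m - s + p = m + p - s by ring]
    unfold starEnd
    split_ifs
    · rw [end_neg_mul]
    · rw [end_mul_neg, aEnd_comm_asEnd n r _ _ (by simp only [ne_eq, Prod.mk.injEq]; omega)]
  · convert lsum_zero using 2
    funext s
    rw [lie_starEnd_of_lie_eq_zero (lie_asEnd_fEnd_of_ne hij i s p), lie_quadMode_fEnd hi' hj,
      if_neg (by omega), if_neg hij, sub_zero]
    unfold starEnd
    split_ifs <;> simp

lemma aEnd_mul_asEnd {i j : ℕ} (h : 1 ≤ i ∧ i ≤ j ∧ j ≤ n) (u v : ℤ) :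
    aEnd n r i j u * asEnd n r i j v = nEnd n r i j u v +
      (if u + v = 0 ∧ j ≤ r then (if 0 ≤ u then (1 : ℂ) else 0) else 0) • 1 := by
  unfold nEnd
  by_cases hu : 0 ≤ u ∧ j ≤ r
  · rw [if_pos hu, ← sub_eq_iff_eq_add', if_pos hu.1, ← Ring.lie_def]
    by_cases huv : u + v = 0
    · rw [lie_aEnd_asEnd_self n r h huv, if_pos ⟨huv, hu.2⟩, one_smul]
    · rw [lie_aEnd_asEnd_of_ne n r (by omega), if_neg (by omega), zero_smul]
  · rw [if_neg hu, left_eq_add]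
    split_ifs
    · omega
    all_goals exact zero_smul _ _

lemma lie_raising_fEnd_self {i k : ℕ} (hi : 1 ≤ i) (hk : i + 1 ≤ k) (hk' : k ≤ n) (m p : ℤ) :
    ⁅prodMode n r (i + 1) k i k m, fEnd n r i p⁆ =
      nMode n r i k (m + p) - nMode n r (i + 1) k (m + p)
        - (if m + p = 0 ∧ k ≤ r then (m : ℂ) else 0) • 1 := by
  set c : ℤ → ℂ := fun s => if m + p = 0 ∧ k ≤ r then
    (if 0 ≤ s + p then (1 : ℂ) else 0) - (if 0 ≤ s then 1 else 0) else 0 with hc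
  have hloc : LocFin fun s => aEnd n r (i + 1) k s * asEnd n r i k (m - s) :=
    prodMode_locFin (by simp) le_rfl m
  have h1 : LocFin fun s => nEnd n r i k (s + p) (m - s) := by
    convert (nEnd_locFin (n := n) (r := r) i k (m + p)).shift p using 3
    ring
  have h2 := nEnd_locFin (n := n) (r := r) (i + 1) k (m + p)
  have key (s : ℤ) : ⁅aEnd n r (i + 1) k s * asEnd n r i k (m - s), fEnd n r i p⁆ =
      nEnd n r i k (s + p) (m - s) - nEnd n r (i + 1) k s (m + p - s) + c s • 1 := by
    rw [mul_lie_eq, lie_asEnd_fEnd_offdiag hi hk hk', lie_aEnd_fEnd_self hk hk', end_mul_neg,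
      aEnd_mul_asEnd (by omega), aEnd_mul_asEnd (by omega),
      show m - s + p = m + p - s by ring, show s + p + (m - s) = m + p by ring,
      show s + (m + p - s) = m + p by ring, hc]
    beta_reduce
    split_ifs <;> module
  have h3 : LocFin fun s => c s • (1 : Module.End ℂ (FSp n)) := by
    convert (hloc.lie (fEnd n r i p)).sub (h1.sub h2) using 2 with s
    rw [key, add_sub_cancel_left]
  have hsum : ∑ᶠ s, c s = -if m + p = 0 ∧ k ≤ r then (m : ℂ) else 0 := by
    simp only [hc]
    split_ifs with h
    · rw [finsum_step_sub, show p = -m by omega, Int.cast_neg]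
    · simp
  rw [prodMode, lsum_lie hloc]
  simp only [key]
  rw [lsum_add (h1.sub h2) h3, lsum_sub h1 h2, lsum_smul_one h3, hsum, end_neg_smul,
    ← sub_eq_add_neg, nMode, nMode, ← lsum_shift (nEnd_locFin i k (m + p)) p]
  simp only [add_sub_add_right_eq_sub]

lemma lie_prodMode_fEnd_eq_zero {i j k l j' : ℕ} (hne : (i, j) ≠ (k, l)) (hjl : j ≤ l)
    (hi : i ≠ j' + 1) (hk : k ≠ j') (m p : ℤ) :
    ⁅prodMode n r i j k l m, fEnd n r j' p⁆ = 0 := by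
  rw [prodMode, lsum_lie (prodMode_locFin hne hjl m)]
  simp only [mul_lie_eq, lie_aEnd_fEnd_of_ne hi, lie_asEnd_fEnd_of_ne hk, mul_zero, zero_mul,
    add_zero, lsum_zero]

lemma lie_lowering_fEnd_succ {i j : ℕ} (hij : j + 1 < i) (hi : i ≤ n) (m p : ℤ) :
    ⁅prodMode n r (j + 1) (i - 1) (j + 1) i m, fEnd n r j p⁆ =
      prodMode n r j (i - 1) (j + 1) i (m + p) := by
  rw [prodMode, lsum_lie (prodMode_locFin (by simp only [ne_eq, Prod.mk.injEq]; omega)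
    (by omega) m), prodMode, ← lsum_shift (prodMode_locFin (by simp) (by omega) (m + p)) p]
  simp only [mul_lie_eq, lie_aEnd_fEnd_self (show j + 1 ≤ i - 1 by omega)
    (show i - 1 ≤ n by omega), lie_asEnd_fEnd_of_ne (show j + 1 ≠ j by omega), mul_zero, zero_add,
    add_sub_add_right_eq_sub]

lemma lie_lowering_fEnd_self {i j : ℕ} (hj : 1 ≤ j) (hij : j < i) (hi : i ≤ n) (m p : ℤ) :
    ⁅prodMode n r j (i - 1) j i m, fEnd n r j p⁆ =
      -prodMode n r j (i - 1) (j + 1) i (m + p) := by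
  rw [prodMode, lsum_lie (prodMode_locFin (by simp only [ne_eq, Prod.mk.injEq]; omega)
    (by omega) m), prodMode, ← lsum_neg (prodMode_locFin (by simp) (by omega) (m + p))]
  simp only [mul_lie_eq, lie_aEnd_fEnd_of_ne (show j ≠ j + 1 by omega),
    lie_asEnd_fEnd_offdiag hj (show j + 1 ≤ i by omega) hi, zero_mul, add_zero, end_mul_neg,
    show ∀ s, m - s + p = m + p - s from fun s => by ring]

lemma sum_lie_lowering_fEnd {i j : ℕ} (hi' : i ≤ n) (hj : 1 ≤ j) (m p : ℤ) :
    ∑ k ∈ Finset.Ico 1 i, ⁅prodMode n r k (i - 1) k i m, fEnd n r j p⁆ =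
      if j + 1 = i then -prodMode n r j j i i (m + p) else 0 := by
  have hzero {k : ℕ} (hk : k ∈ Finset.Ico 1 i) (h1 : k ≠ j) (h2 : k ≠ j + 1) :
      ⁅prodMode n r k (i - 1) k i m, fEnd n r j p⁆ = 0 := by
    rw [Finset.mem_Ico] at hk
    exact lie_prodMode_fEnd_eq_zero (by simp only [ne_eq, Prod.mk.injEq]; omega) (by omega) h2 h1
      m p
  rcases lt_trichotomy (j + 1) i with h | rfl | h
  · rw [if_neg h.ne, Finset.sum_eq_add_of_mem j (j + 1) (Finset.mem_Ico.mpr ⟨hj, by omega⟩)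
      (Finset.mem_Ico.mpr ⟨by omega, h⟩) (by omega), lie_lowering_fEnd_succ h hi',
      lie_lowering_fEnd_self hj (by omega) hi', neg_add_cancel]
    exact fun k hk h => hzero hk h.1 h.2
  · rw [if_pos rfl, Finset.sum_eq_single_of_mem j (Finset.mem_Ico.mpr ⟨hj, by omega⟩),
      lie_lowering_fEnd_self hj (by omega) hi', Nat.add_sub_cancel]
    intro k hk hne
    exact hzero hk hne (Finset.mem_Ico.mp hk).2.ne
  · rw [if_neg h.ne']
    refine Finset.sum_eq_zero fun k hk => ?_
    have := (Finset.mem_Ico.mp hk).2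
    exact hzero hk (by omega) (by omega)

lemma lie_asEnd_bEnd_fEnd (e : ℕ → ℕ → ℂ) (lam : ℕ → ℂ) {i : ℕ} (hi : 1 ≤ i) (hi' : i ≤ n)
    (m p : ℤ) :
    ⁅lsum (fun s => asEnd n r i i s * bEnd n e lam i (m - s)), fEnd n r i p⁆ =
      -bEnd n e lam i (m + p) := by
  rw [lsum_lie (asEnd_bEnd_locFin e lam i i i m), lsum_eq_single (-p)]
  · rw [mul_lie_eq, lie_bEnd_fEnd, lie_asEnd_fEnd_diag hi hi', if_pos (by omega), mul_zero,
      zero_add, end_neg_one_mul, sub_neg_eq_add]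
  · intro s hs
    rw [mul_lie_eq, lie_bEnd_fEnd, lie_asEnd_fEnd_diag hi hi', if_neg (by omega), mul_zero,
      zero_add, zero_mul]

lemma lie_asEnd_bEnd_fEnd_of_ne (e : ℕ → ℕ → ℂ) (lam : ℕ → ℂ) {i j : ℕ} (hij : i ≠ j)
    (m p : ℤ) :
    ⁅lsum (fun s => asEnd n r i i s * bEnd n e lam i (m - s)), fEnd n r j p⁆ = 0 := by
  rw [lsum_lie (asEnd_bEnd_locFin e lam i i i m)]
  simp only [mul_lie_eq, lie_bEnd_fEnd, lie_asEnd_fEnd_of_ne hij, mul_zero, zero_mul, add_zero,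
    lsum_zero]

lemma lie_eEnd_fEnd_of_ne (γ : ℂ) (e : ℕ → ℕ → ℂ) (lam : ℕ → ℂ) {i j : ℕ} (hi' : i ≤ n)
    (hj : 1 ≤ j) (hij : i ≠ j) (m p : ℤ) :
    ⁅eEnd n r γ e lam i m, fEnd n r j p⁆ = 0 := by
  rw [eEnd, sub_lie, sub_lie, sub_lie, add_lie, sum_lie, sum_lie,
    lie_cubic_fEnd_of_ne hi' hj hij, sum_lie_lowering_fEnd hi' hj,
    lie_asEnd_bEnd_fEnd_of_ne e lam hij, smul_lie_eq, smul_lie_eq, lie_asEnd_fEnd_of_ne hij,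
    Finset.sum_eq_zero fun k _ =>
      lie_prodMode_fEnd_eq_zero (by simp) le_rfl (by omega) hij m p]
  simp

lemma sum_ite_le (i : ℕ) (hr : r ≤ n) (x : ℂ) :
    ∑ k ∈ Finset.Icc (i + 1) n, (if k ≤ r then x else 0) =
      (if r < i then 0 else (r : ℂ) - i) * x := by
  rw [← Finset.sum_filter, Finset.sum_const, nsmul_eq_mul,
    show (Finset.Icc (i + 1) n).filter (· ≤ r) = Finset.Icc (i + 1) r by ext; simp; omega,
    Nat.card_Icc, Nat.add_sub_add_right]
  split_ifs with h
  · simp [Nat.sub_eq_zero_of_le h.le]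
  · rw [Nat.cast_sub (by omega)]

lemma lie_eEnd_fEnd_self (γ : ℂ) (e : ℕ → ℕ → ℂ) (lam : ℕ → ℂ) (hr : r ≤ n) {i : ℕ}
    (hi : 1 ≤ i) (hi' : i ≤ n) (m p : ℤ) :
    ⁅eEnd n r γ e lam i m, fEnd n r i p⁆ =
      hEnd n r e lam i (m + p) +
        ((γ ^ 2 - ((r : ℂ) + 1)) * (m : ℂ) * (if m + p = 0 then 1 else 0)) • 1 := by
  have hraise : ∑ k ∈ Finset.Icc (i + 1) n, ⁅prodMode n r (i + 1) k i k m, fEnd n r i p⁆ =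
      ∑ k ∈ Finset.Icc (i + 1) n, (nMode n r i k (m + p) - nMode n r (i + 1) k (m + p))
        - ((if r < i then 0 else (r : ℂ) - i) * if m + p = 0 then (m : ℂ) else 0) • 1 := by
    rw [← sum_ite_le i hr, Finset.sum_smul, ← Finset.sum_sub_distrib]
    refine Finset.sum_congr rfl fun k hk => ?_
    rw [Finset.mem_Icc] at hk
    rw [lie_raising_fEnd_self hi hk.1 hk.2, ite_and]
    congr 2
    split_ifs <;> rfl
  rw [eEnd, sub_lie, sub_lie, sub_lie, add_lie, sum_lie, sum_lie, lie_cubic_fEnd_self hi hi',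
    hraise, sum_lie_lowering_fEnd hi' hi, if_neg (show ¬ i + 1 = i by omega),
    lie_asEnd_bEnd_fEnd e lam hi hi',
    smul_lie_eq, smul_lie_eq, lie_asEnd_fEnd_diag hi hi', hEnd, quadMode,
    ← Finset.Ico_insert_right hi, Finset.sum_insert (by simp),
    Finset.sum_sub_distrib (s := Finset.Ico 1 i)]
  by_cases h0 : m + p = 0
  · rw [if_pos h0, if_pos h0, if_pos h0]
    split_ifs <;> module
  · rw [if_neg h0, if_neg h0, if_neg h0]
    module

end Commutators

/-- relation (R4):
`[ρ(E_i)_m, ρ(F_j)_p] = δ_{ij}(ρ(H_i)_{m+p} + c₀ · m · δ_{m+p,0} · id)`,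
with `c₀ = γ² − (r+1)`. -/
theorem wakimoto_R4 (n r : ℕ) (γ : ℂ) (e : ℕ → ℕ → ℂ) (lam : ℕ → ℂ)
    (hn : 1 ≤ n) (hr : r ≤ n)
    (he : ∀ i j, 1 ≤ i → i ≤ n → 1 ≤ j → j ≤ n →
      (∑ k : Fin n, e i (k.1 + 1) * e j (k.1 + 1)) = Bentry r γ i j)
    (i j : ℕ) (hi : 1 ≤ i) (hi' : i ≤ n) (hj : 1 ≤ j) (hj' : j ≤ n) (m p : ℤ) :
    opComm n (rhoE n r γ e lam i m) (rhoF n r j p) =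
      (if i = j then (1 : ℂ) else 0) •
        (rhoH n r e lam i (m + p) +
          ((γ ^ 2 - ((r : ℂ) + 1)) * (m : ℂ) * (if m + p = 0 then 1 else 0)) •
            (id : FSp n → FSp n)) := by
  have hlie : opComm n (rhoE n r γ e lam i m) (rhoF n r j p) =
      ⇑⁅eEnd n r γ e lam i m, fEnd n r j p⁆ := by
    rw [rhoE_eq γ e lam hi, rhoF_eq]
    rfl
  rw [hlie]
  by_cases hij : i = j
  · subst hij
    rw [if_pos rfl, lie_eEnd_fEnd_self γ e lam hr hi hi', rhoH_eq, one_smul]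
    rfl
  · rw [if_neg hij, lie_eEnd_fEnd_of_ne γ e lam hi' hj hij, zero_smul]
    rfl
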